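/- The Laurent polynomials P_{k,i}^{(r)}(q) of Lemma 1.2 satisfy the recursion: P_{k,k}^{(1)}(q) = 1, and for all r ≥ 1, k ≥ 0 and 0 ≤ j ≤ rk, P_{k,k+j}^{(r+1)}(q) = ∑_{i=k}^{rk} q^{(j−i)(j+k)} · [k+i choose i]_q · [k choose i−j]_q · [k+j choose j]_q · P_{k,i}^{(r)}(q). -/

import Mathlib

open Polynomial LaurentPolynomial Finset

/-- The Gaussian (q-)binomial coefficient `[n choose k]_q` as a polynomial in `q`,
defined by the q-Pascal recursion; it equals `(q)_n / ((q)_k (q)_{n-k})` for `0 ≤ k ≤ n`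
and vanishes for `k > n`. -/
noncomputable def qbinom : ℕ → ℕ → Polynomial ℤ
  | _, 0 => 1
  | 0, _ + 1 => 0
  | n + 1, k + 1 => qbinom n k + Polynomial.X ^ (k + 1) * qbinom n (k + 1)

/-- `[n choose k]_q` viewed as a Laurent polynomial. -/
noncomputable def qb (n k : ℕ) : LaurentPolynomial ℤ := (qbinom n k).toLaurent

/-- `[n choose z]_q` for an integer lower index `z`, vanishing when `z < 0`. -/
noncomputable def qbz (n : ℕ) (z : ℤ) : LaurentPolynomial ℤ :=
  if 0 ≤ z then qb n z.toNat else 0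

lemma qbinom_zero_right (n : ℕ) : qbinom n 0 = 1 := by
  cases n <;> rfl

lemma qbinom_succ_succ (n k : ℕ) :
    qbinom (n + 1) (k + 1) = qbinom n k + Polynomial.X ^ (k + 1) * qbinom n (k + 1) := rfl

lemma qbinom_eq_zero_of_lt {n k : ℕ} (h : n < k) : qbinom n k = 0 := by
  induction n generalizing k with
  | zero =>
    obtain ⟨k, rfl⟩ := Nat.exists_eq_succ_of_ne_zero h.ne'
    rfl
  | succ n ih =>
    obtain ⟨k, rfl⟩ := Nat.exists_eq_succ_of_ne_zero (Nat.ne_zero_of_lt h)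
    rw [Nat.succ_eq_add_one, qbinom_succ_succ, ih (by omega), ih (by omega)]
    simp

lemma qbinom_eval_one (n k : ℕ) : (qbinom n k).eval 1 = (n.choose k : ℤ) := by
  induction n generalizing k with
  | zero => cases k <;> simp [qbinom]
  | succ n ih =>
    cases k with
    | zero => simp [qbinom]
    | succ k => simp [qbinom_succ_succ, ih, Nat.choose_succ_succ]

lemma qbinom_ne_zero {n k : ℕ} (h : k ≤ n) : qbinom n k ≠ 0 := by
  intro h0
  have := qbinom_eval_one n k
  rw [h0, Polynomial.eval_zero] at this
  exact (Nat.choose_pos h).ne' (by exact_mod_cast this.symm)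

/-- Raising the lower index of a Gaussian binomial. -/
lemma qbinom_succ_right_mul (n k : ℕ) :
    Polynomial.X ^ k * (1 - Polynomial.X ^ (k + 1)) * qbinom n (k + 1)
      = (Polynomial.X ^ k - Polynomial.X ^ n) * qbinom n k := by
  induction n generalizing k with
  | zero =>
    cases k with
    | zero => simp [qbinom]
    | succ k => simp [qbinom]
  | succ n ih =>
    cases k with
    | zero =>
      have h := ih 0
      simp only [qbinom_succ_succ, qbinom_zero_right] at h ⊢
      linear_combination Polynomial.X * h
    | succ k =>
      have h₁ := ih (k + 1)
      have h₀ := ih k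
      simp only [qbinom_succ_succ]
      linear_combination Polynomial.X ^ (k + 2) * h₁ + Polynomial.X * h₀

/-- Raising both indices of a Gaussian binomial. -/
lemma qbinom_succ_succ_mul (n k : ℕ) :
    (1 - Polynomial.X ^ (k + 1)) * qbinom (n + 1) (k + 1)
      = (1 - Polynomial.X ^ (n + 1)) * qbinom n k := by
  rw [qbinom_succ_succ]
  linear_combination Polynomial.X * qbinom_succ_right_mul n k

lemma qb_zero_right (n : ℕ) : qb n 0 = 1 := by simp [qb, qbinom_zero_right]

lemma qb_eq_zero_of_lt {n k : ℕ} (h : n < k) : qb n k = 0 := by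
  simp [qb, qbinom_eq_zero_of_lt h]

lemma qb_ne_zero {n k : ℕ} (h : k ≤ n) : qb n k ≠ 0 := by
  simpa [qb] using qbinom_ne_zero h

lemma qb_succ_succ_mul (n k : ℕ) :
    (1 - T ((k : ℤ) + 1)) * qb (n + 1) (k + 1) = (1 - T ((n : ℤ) + 1)) * qb n k := by
  simpa [qb] using congrArg Polynomial.toLaurent (qbinom_succ_succ_mul n k)

lemma qb_succ_right_mul (n k : ℕ) :
    (1 - T ((k : ℤ) + 1)) * qb n (k + 1) = (1 - T ((n : ℤ) - k)) * qb n k := by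
  have h := congrArg Polynomial.toLaurent (qbinom_succ_right_mul n k)
  simp only [map_mul, map_sub, map_one, Polynomial.toLaurent_X_pow, Nat.cast_add,
    Nat.cast_one] at h
  have hk : (T (-(k : ℤ)) * T (k : ℤ) : LaurentPolynomial ℤ) = 1 := by rw [← T_add]; simp
  have hn : (T ((n : ℤ) - k) : LaurentPolynomial ℤ) = T (-(k : ℤ)) * T (n : ℤ) := by
    rw [← T_add]; congr 1; ring
  rw [hn]
  simp only [qb]
  linear_combination T (-(k : ℤ)) * h + ((qbinom n k).toLaurent -
    (1 - T ((k : ℤ) + 1)) * (qbinom n (k + 1)).toLaurent) * hk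

lemma qbz_natCast (n k : ℕ) : qbz n (k : ℤ) = qb n k := by simp [qbz]

lemma qbz_of_neg (n : ℕ) {z : ℤ} (h : z < 0) : qbz n z = 0 := by simp [qbz, h]

lemma qbz_succ_mul (n : ℕ) (z : ℤ) :
    (1 - T (z + 1)) * qbz n (z + 1) = (1 - T ((n : ℤ) - z)) * qbz n z := by
  rcases lt_or_ge z 0 with h | h
  · rw [qbz_of_neg n h]
    rcases (show z + 1 ≤ 0 by omega).lt_or_eq with h' | h'
    · simp [qbz_of_neg n h']
    · simp [h']
  · lift z to ℕ using h
    have := qb_succ_right_mul n z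
    rw [← qbz_natCast n (z + 1), ← qbz_natCast n z] at this
    exact_mod_cast this

lemma one_sub_T_ne_zero (n : ℕ) : (1 - T ((n : ℤ) + 1) : LaurentPolynomial ℤ) ≠ 0 := by
  intro h
  have h' : (1 - Polynomial.X ^ (n + 1) : Polynomial ℤ).toLaurent = 0 := by
    simpa using h
  have := congrArg (Polynomial.eval 0) (Polynomial.toLaurent_eq_zero.mp h')
  simp at this

/-- The product `[n choose i]_q [n+i choose i]_q`. -/
noncomputable def schmidtBasis (n i : ℕ) : LaurentPolynomial ℤ := qb n i * qb (n + i) i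

lemma schmidtBasis_succ_mul (n i : ℕ) :
    (1 - T ((i : ℤ) + 1)) ^ 2 * schmidtBasis n (i + 1)
      = (1 - T ((n : ℤ) - i)) * (1 - T ((n : ℤ) + i + 1)) * schmidtBasis n i := by
  have h₁ := qb_succ_right_mul n i
  have h₂ := qb_succ_succ_mul (n + i) i
  push_cast at h₂
  simp only [schmidtBasis, ← add_assoc]
  linear_combination (1 - T ((i : ℤ) + 1)) * qb (n + i + 1) (i + 1) * h₁ +
    (1 - T ((n : ℤ) - i)) * qb n i * h₂

/-- The coefficients expanding the product of two basis elements in the basis. -/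
noncomputable def linCoeff (k i j : ℕ) : LaurentPolynomial ℤ :=
  T (((j : ℤ) - i) * ((j : ℤ) + k)) * qb (k + i) i * qbz k ((i : ℤ) - j) * qb (k + j) j

lemma linCoeff_eq_zero_of_lt {k i j : ℕ} (h : i < j) : linCoeff k i j = 0 := by
  simp [linCoeff, qbz_of_neg k (show (i : ℤ) - j < 0 by omega)]

lemma T_mul_T_neg (m : ℤ) : (T m * T (-m) : LaurentPolynomial ℤ) = 1 := by rw [← T_add]; simp

lemma linCoeff_succ_zero_mul (k i : ℕ) :
    (1 - T ((i : ℤ) + 1)) ^ 2 * linCoeff k (i + 1) 0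
      = T (-(k : ℤ)) * (1 - T ((k : ℤ) - i)) * (1 - T ((k : ℤ) + i + 1)) * linCoeff k i 0 := by
  have h₁ := qb_succ_succ_mul (k + i) i
  have h₂ := qbz_succ_mul k i
  have hT : (T ((0 - ((i : ℤ) + 1)) * (0 + k)) : LaurentPolynomial ℤ)
      = T (-(k : ℤ)) * T ((0 - (i : ℤ)) * (0 + k)) := by
    rw [← T_add]; congr 1; ring
  simp only [linCoeff, Nat.cast_add, Nat.cast_one, Nat.cast_zero, sub_zero, ← add_assoc,
    qb_zero_right, mul_one] at h₁ ⊢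
  rw [hT]
  linear_combination T (-(k : ℤ)) * T ((0 - (i : ℤ)) * (0 + k)) *
    ((1 - T ((i : ℤ) + 1)) * qbz k (i + 1) * h₁ + (1 - T ((k : ℤ) + i + 1)) * qb (k + i) i * h₂)

lemma linCoeff_succ_succ_mul (k i j : ℕ) :
    (1 - T ((i : ℤ) + 1)) ^ 2 * linCoeff k (i + 1) (j + 1)
      = (1 - T ((k : ℤ) + j + 1)) ^ 2 * linCoeff k i j +
        T (-((k : ℤ) + j + 1)) * (1 - T ((k : ℤ) + j + 1 - i)) *
          (1 - T ((k : ℤ) + j + 1 + i + 1)) * linCoeff k i (j + 1) := by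
  have h₁ := qb_succ_succ_mul (k + i) i
  have h₂ := qb_succ_succ_mul (k + j) j
  have h₃ := qbz_succ_mul k ((i : ℤ) - j - 1)
  have hF₂ : (T (((j : ℤ) - i) * (j + k)) : LaurentPolynomial ℤ)
      = T (((j : ℤ) - i) * (j + 1 + k)) * T ((i : ℤ) - j) := by
    rw [← T_add]; congr 1; ring
  have hF₃ : (T (((j : ℤ) + 1 - i) * (j + 1 + k)) : LaurentPolynomial ℤ)
      = T (((j : ℤ) - i) * (j + 1 + k)) * T ((k : ℤ) + j + 1) := by
    rw [← T_add]; congr 1; ring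
  have hc := T_mul_T_neg ((k : ℤ) + j + 1)
  have e₁ : (i : ℤ) + 1 - (j + 1) = i - j := by ring
  have e₂ : (j : ℤ) + 1 - (i + 1) = j - i := by ring
  have e₃ : (i : ℤ) - (j + 1) = i - j - 1 := by ring
  have e₄ : (k : ℤ) - (i - j - 1) = k + j + 1 - i := by ring
  rw [sub_add_cancel, e₄] at h₃
  simp only [linCoeff, Nat.cast_add, Nat.cast_one, ← add_assoc, e₁, e₂, e₃] at h₁ h₂ ⊢
  rw [hF₂, hF₃]
  have hT₁ : (T ((i : ℤ) + 1) : LaurentPolynomial ℤ) = T ((j : ℤ) + 1) * T ((i : ℤ) - j) := by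
    rw [← T_add]; congr 1; ring
  have hT₂ : (T ((k : ℤ) + i + 1) : LaurentPolynomial ℤ) = T (k : ℤ) * T ((j : ℤ) + 1) *
      T ((i : ℤ) - j) := by
    rw [← T_add, ← T_add]; congr 1; ring
  have hT₃ : (T ((k : ℤ) + j + 1) : LaurentPolynomial ℤ) = T (k : ℤ) * T ((j : ℤ) + 1) := by
    rw [← T_add, ← add_assoc]
  have hT₄ : (T ((k : ℤ) + j + 1 + i + 1) : LaurentPolynomial ℤ) = T (k : ℤ) *
      T ((j : ℤ) + 1) * (T ((j : ℤ) + 1) * T ((i : ℤ) - j)) := by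
    rw [← T_add, ← T_add, ← T_add]; congr 1; ring
  rw [hT₃] at hc h₂ ⊢
  rw [hT₂, hT₁] at h₁
  rw [hT₁, hT₄]
  generalize (T ((j : ℤ) + 1) : LaurentPolynomial ℤ) = b at *
  generalize (T ((i : ℤ) - j) : LaurentPolynomial ℤ) = d at *
  generalize (T (k : ℤ) : LaurentPolynomial ℤ) = c at *
  generalize (T (-((k : ℤ) + j + 1)) : LaurentPolynomial ℤ) = u at *
  generalize (T (((j : ℤ) - i) * (j + 1 + k)) : LaurentPolynomial ℤ) = F at *
  generalize (T ((k : ℤ) + j + 1 - i) : LaurentPolynomial ℤ) = w at *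
  generalize qb (k + i + 1) (i + 1) = I' at *
  generalize qb (k + j + 1) (j + 1) = J' at *
  generalize qb (k + i) i = I at *
  generalize qb (k + j) j = J at *
  generalize qbz k ((i : ℤ) - j) = B' at *
  generalize qbz k ((i : ℤ) - j - 1) = B at *
  linear_combination (1 - b * d) * F * B' * J' * h₁ + (1 - c * b) * d * F * I * B' * h₂ +
    F * (1 - c * b * (b * d)) * I * J' * h₃ -
    (1 - w) * (1 - c * b * (b * d)) * F * I * B * J' * hc

/-- Linearization of a product of two basis elements. -/
lemma T_mul_schmidtBasis_mul_schmidtBasis (n k L i : ℕ) (hi : i ≤ L) :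
    T (-((i : ℤ) * n)) * schmidtBasis n i * schmidtBasis n k
      = ∑ j ∈ range (L + 1), T (-((j : ℤ) * n)) * schmidtBasis n (k + j) * linCoeff k i j := by
  induction i with
  | zero =>
    rw [sum_range_succ', sum_eq_zero fun j _ => by
      rw [linCoeff_eq_zero_of_lt (Nat.succ_pos j), mul_zero]]
    simp [schmidtBasis, linCoeff, qb_zero_right, qbz]
  | succ i ih =>
    have ih := ih (by omega)
    refine mul_left_cancel₀ (pow_ne_zero 2 (one_sub_T_ne_zero i)) ?_
    have step (j : ℕ) :
        T (-(n : ℤ)) * ((1 - T ((n : ℤ) - i)) * (1 - T ((n : ℤ) + i + 1))) *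
          (T (-((j : ℤ) * n)) * schmidtBasis n (k + j) * linCoeff k i j)
        = T (-(((j + 1 : ℕ) : ℤ) * n)) * schmidtBasis n (k + (j + 1)) *
            ((1 - T ((k : ℤ) + j + 1)) ^ 2 * linCoeff k i j) +
          T (-((j : ℤ) * n)) * schmidtBasis n (k + j) *
            (T (-((k : ℤ) + j)) * (1 - T ((k : ℤ) + j - i)) *
              (1 - T ((k : ℤ) + j + i + 1)) * linCoeff k i j) := by
      have h := schmidtBasis_succ_mul n (k + j)
      have hT : (T (-(((j + 1 : ℕ) : ℤ) * n)) : LaurentPolynomial ℤ)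
          = T (-(n : ℤ)) * T (-((j : ℤ) * n)) := by
        rw [← T_add]; congr 1; push_cast; ring
      have key : (T (-(n : ℤ)) * ((1 - T ((n : ℤ) - i)) * (1 - T ((n : ℤ) + i + 1))) :
            LaurentPolynomial ℤ)
          = T (-(n : ℤ)) * ((1 - T ((n : ℤ) - ((k : ℤ) + j))) *
              (1 - T ((n : ℤ) + ((k : ℤ) + j) + 1))) +
            T (-((k : ℤ) + j)) * (1 - T ((k : ℤ) + j - i)) * (1 - T ((k : ℤ) + j + i + 1)) := by
        simp only [mul_sub, sub_mul, mul_one, one_mul, ← T_add]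
        ring_nf
      push_cast at h
      rw [key, hT, ← add_assoc k j 1]
      linear_combination -T (-(n : ℤ)) * T (-((j : ℤ) * n)) * linCoeff k i j * h
    have hT : (T (-(((i + 1 : ℕ) : ℤ) * n)) : LaurentPolynomial ℤ)
        = T (-(n : ℤ)) * T (-((i : ℤ) * n)) := by
      rw [← T_add]; congr 1; push_cast; ring
    calc _ = T (-(n : ℤ)) * ((1 - T ((n : ℤ) - i)) * (1 - T ((n : ℤ) + i + 1))) *
          (T (-((i : ℤ) * n)) * schmidtBasis n i * schmidtBasis n k) := by
          rw [hT]
          linear_combination T (-(n : ℤ)) * T (-((i : ℤ) * n)) * schmidtBasis n k *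
            schmidtBasis_succ_mul n i
      _ = _ := by
          rw [ih, mul_sum, sum_congr rfl fun j _ => step j, sum_add_distrib, sum_range_succ,
            linCoeff_eq_zero_of_lt (show i < L by omega), mul_zero, mul_zero, add_zero,
            sum_range_succ', ← add_assoc, ← sum_add_distrib, mul_sum, sum_range_succ']
          congr 1
          · refine sum_congr rfl fun j _ => ?_
            have h := linCoeff_succ_succ_mul k i j
            push_cast
            simp only [← add_assoc]
            linear_combination -T (-(((j : ℤ) + 1) * n)) * schmidtBasis n (k + j + 1) * h
          · have h := linCoeff_succ_zero_mul k i
            simp only [Nat.cast_zero, add_zero]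
            linear_combination -T (-((0 : ℤ) * n)) * schmidtBasis n k * h

/-- Expansions in the basis `schmidtBasis n`, valid for all `n ≥ k`, have unique coefficients. -/
lemma schmidtBasis_coeff_unique {k N : ℕ} {f g : ℕ → LaurentPolynomial ℤ}
    (h : ∀ n, k ≤ n →
      ∑ m ∈ Icc k N, T (((N : ℤ) - m) * n) * schmidtBasis n m * f m
        = ∑ m ∈ Icc k N, T (((N : ℤ) - m) * n) * schmidtBasis n m * g m)
    {m : ℕ} (hkm : k ≤ m) (hmN : m ≤ N) : f m = g m := by
  induction m using Nat.strong_induction_on with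
  | _ m ih =>
    have hm := h m hkm
    have hmem : m ∈ Icc k N := mem_Icc.mpr ⟨hkm, hmN⟩
    rw [← add_sum_erase _ _ hmem, ← add_sum_erase _ _ hmem] at hm
    have hrest : ∀ l ∈ (Icc k N).erase m,
        T (((N : ℤ) - l) * m) * schmidtBasis m l * f l
          = T (((N : ℤ) - l) * m) * schmidtBasis m l * g l := by
      intro l hl
      rw [mem_erase, mem_Icc] at hl
      rcases lt_or_gt_of_ne hl.1 with hlt | hgt
      · rw [ih l hlt hl.2.1 hl.2.2]
      · simp [schmidtBasis, qb_eq_zero_of_lt hgt]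
    rw [sum_congr rfl hrest] at hm
    refine mul_left_cancel₀ (mul_ne_zero (isUnit_T _).ne_zero ?_) (add_right_cancel hm)
    exact mul_ne_zero (qb_ne_zero le_rfl) (qb_ne_zero (by omega))

/-- The recursion for the Laurent polynomials `P_{k,i}^{(r)}(q)` of Lemma 1.2:
`P_{k,k}^{(1)}(q) = 1` and, for `r ≥ 1`, `k ≥ 0`, `0 ≤ j ≤ rk`,
`P_{k,k+j}^{(r+1)}(q) = ∑_{i=k}^{rk} q^{(j-i)(j+k)} [k+i,i]_q [k,i-j]_q [k+j,j]_q P_{k,i}^{(r)}(q)`.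
Here `P r k i` denotes `P_{k,i}^{(r)}(q)`, characterized by the defining property of
Lemma 1.2 expressed by the hypotheses. -/
theorem qSchmidt_recursion
    (P : ℕ → ℕ → ℕ → LaurentPolynomial ℤ)
    (hPsupp : ∀ r k i : ℕ, i < k ∨ r * k < i → P r k i = 0)
    (hPnonneg : ∀ r k i : ℕ, ∀ m : ℤ, 0 ≤ (P r k i).coeff m)
    (hPid : ∀ r : ℕ, 1 ≤ r → ∀ k n : ℕ, k ≤ n →
      qb n k ^ r * qb (n + k) k ^ r
        = ∑ i ∈ Icc k (min n (r * k)),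
            T (((r : ℤ) * k - i) * n) * qb n i * qb (n + i) i * P r k i) :
    (∀ k : ℕ, P 1 k k = 1) ∧
    ∀ r k j : ℕ, 1 ≤ r → j ≤ r * k →
      P (r + 1) k (k + j)
        = ∑ i ∈ Icc k (r * k),
            T (((j : ℤ) - i) * ((j : ℤ) + k)) *
              qb (k + i) i * qbz k ((i : ℤ) - j) * qb (k + j) j * P r k i := by
  have hbasis : ∀ r : ℕ, 1 ≤ r → ∀ k n : ℕ, k ≤ n →
      schmidtBasis n k ^ r
        = ∑ i ∈ Icc k (r * k), T ((((r * k : ℕ) : ℤ) - i) * n) * schmidtBasis n i * P r k i := by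
    intro r hr k n hkn
    rw [schmidtBasis, mul_pow, hPid r hr k n hkn]
    refine (sum_congr rfl fun i _ => ?_).trans
      (sum_subset (Icc_subset_Icc_right (min_le_right n (r * k))) fun i hi hi' => ?_)
    · rw [schmidtBasis, mul_assoc (T _)]
      push_cast
      rfl
    · rw [mem_Icc] at hi hi'
      have hni : n < i := by
        by_contra! hin
        exact hi' ⟨hi.1, le_min hin hi.2⟩
      simp [schmidtBasis, qb_eq_zero_of_lt hni]
  refine ⟨fun k => ?_, fun r k j hr hj => ?_⟩
  · have h := hbasis 1 le_rfl k k le_rfl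
    simp only [one_mul, Icc_self, sum_singleton, sub_self, zero_mul, T_zero, pow_one] at h
    have h0 : schmidtBasis k k ≠ 0 := mul_ne_zero (qb_ne_zero le_rfl) (qb_ne_zero (by omega))
    exact (mul_left_cancel₀ h0 ((mul_one _).trans h)).symm
  · have hN : (r + 1) * k = k + r * k := by ring
    have huniq := schmidtBasis_coeff_unique (k := k) (N := (r + 1) * k) (f := P (r + 1) k)
      (g := fun m => ∑ i ∈ Icc k (r * k), linCoeff k i (m - k) * P r k i) ?_
      (Nat.le_add_right k j) (hN ▸ Nat.add_le_add_left hj k)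
    · simpa only [Nat.add_sub_cancel_left, linCoeff] using huniq
    · intro n hkn
      rw [← hbasis (r + 1) (by omega) k n hkn, pow_succ, hbasis r hr k n hkn, hN,
        ← Ico_add_one_right_eq_Icc k (k + r * k), sum_Ico_eq_sum_range, add_assoc,
        Nat.add_sub_cancel_left, sum_mul]
      simp only [Nat.add_sub_cancel_left, mul_sum]
      rw [sum_comm]
      refine sum_congr rfl fun i hi => ?_
      have hlin := T_mul_schmidtBasis_mul_schmidtBasis n k (r * k) i (mem_Icc.mp hi).2
      have hT (l : ℕ) : (T ((((r * k : ℕ) : ℤ) - l) * n) : LaurentPolynomial ℤ)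
          = T (((r * k : ℕ) : ℤ) * n) * T (-((l : ℤ) * n)) := by
        rw [← T_add]; congr 1; ring
      have hshift (l : ℕ) : ((k + r * k : ℕ) : ℤ) - ((k + l : ℕ) : ℤ) = ((r * k : ℕ) : ℤ) - l := by
        push_cast; ring
      calc _ = T (((r * k : ℕ) : ℤ) * n) * P r k i *
            (T (-((i : ℤ) * n)) * schmidtBasis n i * schmidtBasis n k) := by
            rw [hT]; ring
        _ = _ := by
            rw [hlin, mul_sum]
            refine sum_congr rfl fun l _ => ?_
            rw [hshift, hT]; ring
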